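/- Let x̄ be a local minimum of problem (P), where f is α-strongly convex and L-smooth with 0 < α < L, and Assumption 2 holds. Then there exists μ_max > 0 such that for every μ ∈ (0, μ_max] there exist r_μ > 0, m_μ > 0 and C_μ ≥ 0 such that the exterior-point minimization function f + ι̂_μ is m_μ-strongly convex on the open ball B(x̄, r_μ), is differentiable at every point of B(x̄, r_μ), and its gradient is C_μ-Lipschitz on B(x̄, r_μ). -/

import Mathlib

open Filter Topology Metric

/-- `p` is a nearest point of `X` to `y`. -/
def IsNearestPoint {E : Type*} [NormedAddCommGroup E] (X : Set E) (y p : E) : Prop :=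
  p ∈ X ∧ ‖y - p‖ = infDist y X

lemma exists_isNearestPoint {E : Type*} [NormedAddCommGroup E] [ProperSpace E] {X : Set E}
    (hne : X.Nonempty) (hcl : IsClosed X) (y : E) : ∃ p, IsNearestPoint X y p := by
  obtain ⟨p, hp, h⟩ := hcl.exists_infDist_eq_dist hne y
  exact ⟨p, hp, by rw [h, dist_eq_norm]⟩

/-- A nearest-point selection is continuous wherever the nearest point is unique. -/
lemma continuousAt_of_isNearestPoint {E : Type*} [NormedAddCommGroup E] [ProperSpace E]
    {X : Set E} (hcl : IsClosed X) {P : E → E} (hP : ∀ y, IsNearestPoint X y (P y)) {y : E}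
    (huniq : ∀ p, IsNearestPoint X y p → p = P y) : ContinuousAt P y := by
  have hc : IsCompact (X ∩ closedBall y (infDist y X + 2)) :=
    (isCompact_closedBall _ _).inter_left hcl
  refine hc.tendsto_nhds_of_unique_mapClusterPt ?_ ?_
  · filter_upwards [ball_mem_nhds y one_pos] with w hw
    refine ⟨(hP w).1, ?_⟩
    have h1 : infDist w X ≤ infDist y X + dist w y := infDist_le_infDist_add_dist
    have h2 : dist (P w) y ≤ dist (P w) w + dist w y := dist_triangle _ _ _
    have h3 : dist (P w) w = infDist w X := by rw [dist_comm, dist_eq_norm, (hP w).2]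
    rw [mem_ball] at hw
    rw [mem_closedBall]
    linarith
  · intro p hp hcp
    refine huniq p ⟨hp.1, ?_⟩
    have h1 : Tendsto (fun w => dist y (P w)) (𝓝 y) (𝓝 (infDist y X)) := by
      have hd : Tendsto (fun w => infDist w X) (𝓝 y) (𝓝 (infDist y X)) :=
        (continuous_infDist_pt X).tendsto y
      have hw : Tendsto (fun w => dist w y) (𝓝 y) (𝓝 0) :=
        tendsto_iff_dist_tendsto_zero.1 tendsto_id
      have hlo := hd.sub hw
      have hhi := hd.add hw
      rw [sub_zero] at hlo
      rw [add_zero] at hhi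
      refine tendsto_of_tendsto_of_tendsto_of_le_of_le hlo hhi (fun w => ?_) (fun w => ?_)
      · have h3 : dist w (P w) = infDist w X := by rw [dist_eq_norm, (hP w).2]
        have := dist_triangle w y (P w)
        simp only
        linarith
      · have h3 : dist w (P w) = infDist w X := by rw [dist_eq_norm, (hP w).2]
        have := dist_triangle y w (P w)
        have := dist_comm y w
        simp only
        linarith
    have h2 : MapClusterPt (dist y p) (𝓝 y) (fun w => dist y (P w)) :=
      hcp.continuousAt_comp (f := fun q => dist y q) (by fun_prop)
    rw [← dist_eq_norm]
    exact eq_of_nhds_neBot (h2.neBot.mono (inf_le_inf_left _ h1))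

section Inner

variable {E : Type*} [NormedAddCommGroup E] [InnerProductSpace ℝ E]

lemma IsNearestPoint.infDist_sq_le {X : Set E} {y p : E} (hp : IsNearestPoint X y p) (w : E) :
    infDist w X ^ 2 ≤ infDist y X ^ 2 + 2 * inner ℝ (y - p) (w - y) + ‖w - y‖ ^ 2 := by
  have h : infDist w X ≤ ‖w - p‖ := by
    rw [← dist_eq_norm]; exact infDist_le_dist_of_mem hp.1
  have h2 : infDist w X ^ 2 ≤ ‖w - p‖ ^ 2 := pow_le_pow_left₀ infDist_nonneg h 2
  have h3 : w - p = (y - p) + (w - y) := by abel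
  rw [h3, norm_add_sq_real, hp.2] at h2
  exact h2

/-- Moving away from a set at which nearest points are unique, the distance to the set can be
increased by the full length of the displacement. -/
lemma exists_infDist_eq_add [FiniteDimensional ℝ E] {X : Set E} (hcl : IsClosed X)
    {P : E → E} (hP : ∀ y, IsNearestPoint X y (P y)) {y : E} {ε : ℝ} (hε : 0 ≤ ε)
    (hy : 0 < infDist y X)
    (huniq : ∀ z ∈ closedBall y ε, ∀ p, IsNearestPoint X z p → p = P z) :
    ∃ z ∈ closedBall y ε, infDist y X + ε ≤ infDist z X := by
  have hK : IsCompact (closedBall y ε) := isCompact_closedBall _ _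
  have hKne : (closedBall y ε).Nonempty := ⟨y, mem_closedBall_self hε⟩
  obtain ⟨z₀, hz₀, hmax₀⟩ := hK.exists_isMaxOn hKne (continuous_infDist_pt X).continuousOn
  refine ⟨z₀, hz₀, ?_⟩
  have key : ∀ c : ℝ, 0 ≤ c → c < 1 → infDist y X + c * ε ≤ infDist z₀ X := by
    intro c hc0 hc1
    obtain ⟨z, hz, hmax⟩ := hK.exists_isMaxOn hKne
      (f := fun z => infDist z X - c * ‖z - y‖)
      (((continuous_infDist_pt X).sub (by fun_prop)).continuousOn)
    have hzy : infDist y X ≤ infDist z X - c * ‖z - y‖ := by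
      simpa using hmax (mem_closedBall_self hε)
    suffices hze : ε ≤ ‖z - y‖ by
      have h1 : infDist z X ≤ infDist z₀ X := hmax₀ hz
      have h2 := mul_le_mul_of_nonneg_left hze hc0
      linarith
    by_contra! hlt
    have hd : 0 < infDist z X := by
      have := mul_nonneg hc0 (norm_nonneg (z - y))
      linarith
    have hnz : ‖z - P z‖ = infDist z X := (hP z).2
    obtain ⟨u, hu⟩ : ∃ u : E, u = (infDist z X)⁻¹ • (z - P z) := ⟨_, rfl⟩
    have hu1 : ‖u‖ = 1 := by
      rw [hu, norm_smul, hnz, norm_inv, Real.norm_of_nonneg hd.le, inv_mul_cancel₀ hd.ne']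
    have hui : inner ℝ u (z - P z) = infDist z X := by
      rw [hu, real_inner_smul_left, real_inner_self_eq_norm_sq, hnz]
      field_simp
    have hcont : ContinuousAt P z := continuousAt_of_isNearestPoint hcl hP (huniq z hz)
    have hline : Tendsto (fun t : ℝ => z + t • u) (𝓝[>] 0) (𝓝 z) := by
      have : Continuous (fun t : ℝ => z + t • u) := by fun_prop
      have h := this.tendsto 0
      simp only [zero_smul, add_zero] at h
      exact h.mono_left nhdsWithin_le_nhds
    have hlim1 : Tendsto (fun t : ℝ => 2 * inner ℝ u ((z + t • u) - P (z + t • u))) (𝓝[>] 0)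
        (𝓝 (2 * inner ℝ u (z - P z))) :=
      (tendsto_const_nhds.inner (hline.sub (hcont.tendsto.comp hline))).const_mul 2
    have hlim2 : Tendsto (fun t : ℝ => 2 * c * infDist z X + (c ^ 2 + 1) * t) (𝓝[>] 0)
        (𝓝 (2 * c * infDist z X)) := by
      have : Continuous (fun t : ℝ => 2 * c * infDist z X + (c ^ 2 + 1) * t) := by fun_prop
      have h := this.tendsto 0
      simp only [mul_zero, add_zero] at h
      exact h.mono_left nhdsWithin_le_nhds
    have hle : 2 * inner ℝ u (z - P z) ≤ 2 * c * infDist z X := by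
      refine le_of_tendsto_of_tendsto hlim1 hlim2 ?_
      have hsmall : Set.Ioo (0 : ℝ) (ε - ‖z - y‖) ∈ 𝓝[>] (0 : ℝ) :=
        Ioo_mem_nhdsGT (by linarith)
      filter_upwards [hsmall] with t ht
      have ht0 : 0 < t := ht.1
      have htu : ‖t • u‖ = t := by rw [norm_smul, hu1, mul_one, Real.norm_of_nonneg ht0.le]
      have hwy : ‖z + t • u - y‖ ≤ ‖z - y‖ + t := by
        have h3 : z + t • u - y = (z - y) + t • u := by abel
        rw [h3, ← htu]
        simpa [htu] using norm_add_le (z - y) (t • u)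
      have hwK : z + t • u ∈ closedBall y ε := by
        rw [mem_closedBall, dist_eq_norm]; linarith [ht.2]
      have h4 : infDist (z + t • u) X - c * ‖z + t • u - y‖ ≤ infDist z X - c * ‖z - y‖ :=
        hmax hwK
      have h5 : infDist (z + t • u) X ≤ infDist z X + c * t := by
        have := mul_le_mul_of_nonneg_left hwy hc0
        linarith
      have h6 : infDist (z + t • u) X ^ 2 ≤ (infDist z X + c * t) ^ 2 :=
        pow_le_pow_left₀ infDist_nonneg h5 2
      have h7 := (hP (z + t • u)).infDist_sq_le z
      have h8 : z - (z + t • u) = -(t • u) := by abel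
      rw [h8, norm_neg, htu, inner_neg_right, real_inner_smul_right, real_inner_comm] at h7
      have h9 : t * (2 * inner ℝ u (z + t • u - P (z + t • u)))
          ≤ t * (2 * c * infDist z X + (c ^ 2 + 1) * t) := by linarith
      exact le_of_mul_le_mul_left h9 ht0
    rw [hui] at hle
    have := mul_lt_mul_of_pos_right hc1 hd
    linarith
  have hlim : Tendsto (fun c : ℝ => infDist y X + c * ε) (𝓝[<] 1) (𝓝 (infDist y X + 1 * ε)) :=
    (Continuous.tendsto (by fun_prop) 1).mono_left nhdsWithin_le_nhds
  rw [one_mul] at hlim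
  refine le_of_tendsto hlim ?_
  filter_upwards [Ioo_mem_nhdsLT (zero_lt_one (α := ℝ))] with c hc
  exact key c hc.1.le hc.2

/-- The proximal normal inequality, with a radius given by the size of a ball around `y` on which
nearest points are unique. -/
lemma inner_sub_le_of_unique_isNearestPoint [FiniteDimensional ℝ E] {X : Set E}
    (hcl : IsClosed X) {P : E → E} (hP : ∀ y, IsNearestPoint X y (P y)) {y : E} {ε : ℝ}
    (hε : 0 < ε) (huniq : ∀ z ∈ closedBall y ε, ∀ p, IsNearestPoint X z p → p = P z)
    {b : E} (hb : b ∈ X) :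
    2 * ε * inner ℝ (y - P y) (b - P y) ≤ infDist y X * ‖b - P y‖ ^ 2 := by
  rcases (infDist_nonneg (x := y) (s := X)).eq_or_lt with h0 | hy
  · have : y - P y = 0 := by rw [← norm_eq_zero, (hP y).2, ← h0]
    rw [this, ← h0]; simp
  obtain ⟨z, hz, hzd⟩ := exists_infDist_eq_add hcl hP hε.le hy huniq
  rw [mem_closedBall, dist_eq_norm] at hz
  have hzX : ∀ a ∈ X, infDist y X + ε ≤ ‖z - a‖ := fun a ha => by
    rw [← dist_eq_norm]; exact hzd.trans (infDist_le_dist_of_mem ha)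
  have hn := (hP y).2
  have hsplit : z - P y = (z - y) + (y - P y) := by abel
  have h1 := hzX _ (hP y).1
  have h2 : ‖z - P y‖ ≤ ‖z - y‖ + ‖y - P y‖ := by rw [hsplit]; exact norm_add_le _ _
  have hzy : ‖z - y‖ = ε := by linarith
  have hray : SameRay ℝ (z - y) (y - P y) := by
    rw [sameRay_iff_norm_add, ← hsplit]; linarith
  rw [sameRay_iff_norm_smul_eq, hzy, hn] at hray
  have hd2 : infDist y X + ε ≤ ‖(z - y) + (y - P y) - (b - P y)‖ := by
    have := hzX b hb
    convert this using 2
    abel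
  have hsq := pow_le_pow_left₀ (by positivity) hd2 2
  have hin : infDist y X * inner ℝ (z - y) (b - P y) = ε * inner ℝ (y - P y) (b - P y) := by
    rw [← real_inner_smul_left, ← real_inner_smul_left, hray]
  have hpn : ‖(z - y) + (y - P y)‖ = infDist y X + ε := by rw [← hsplit]; linarith
  rw [norm_sub_sq_real, hpn, inner_add_left] at hsq
  have h3 : 2 * (inner ℝ (z - y) (b - P y) + inner ℝ (y - P y) (b - P y)) ≤ ‖b - P y‖ ^ 2 := by
    linarith
  have h4 := mul_le_mul_of_nonneg_left h3 hy.le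
  rcases le_total 0 (inner ℝ (y - P y) (b - P y)) with h5 | h5
  · have := mul_nonneg hy.le h5
    linarith
  · have h6 := mul_nonneg hy.le (sq_nonneg ‖b - P y‖)
    have h7 := mul_nonneg hε.le (neg_nonneg.2 h5)
    linarith

/-- If the nearest-point selection satisfies the proximal normal inequality on a set, with a
constant at most `1 / 2`, then it is `2`-Lipschitz there. -/
lemma norm_sub_le_of_inner_le {P : E → E} {k : ℝ} (hk : k ≤ 1 / 2) {y w : E}
    (hy : 2 * inner ℝ (y - P y) (P w - P y) ≤ k * ‖P w - P y‖ ^ 2)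
    (hw : 2 * inner ℝ (w - P w) (P y - P w) ≤ k * ‖P y - P w‖ ^ 2) :
    ‖P w - P y‖ ≤ 2 * ‖w - y‖ := by
  rw [norm_sub_rev (P y), ← neg_sub (P w) (P y), inner_neg_right] at hw
  have h1 : inner ℝ (w - P w) (P w - P y) - inner ℝ (y - P y) (P w - P y)
      = inner ℝ (w - y) (P w - P y) - ‖P w - P y‖ ^ 2 := by
    rw [← inner_sub_left, ← real_inner_self_eq_norm_sq, ← inner_sub_left]
    congr 1; abel
  have h2 := real_inner_le_norm (w - y) (P w - P y)
  have h3 := mul_le_mul_of_nonneg_right hk (sq_nonneg ‖P w - P y‖)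
  have h4 : ‖P w - P y‖ * ‖P w - P y‖ ≤ ‖P w - P y‖ * (2 * ‖w - y‖) := by linarith
  rcases (norm_nonneg (P w - P y)).eq_or_lt with h0 | h0
  · rw [← h0]; positivity
  · exact le_of_mul_le_mul_left h4 h0

lemma le_infDist_sq_of_inner_le {X : Set E} {P : E → E} (hP : ∀ y, IsNearestPoint X y (P y))
    {k : ℝ} (hk0 : 0 ≤ k) {y w : E}
    (hy : 2 * inner ℝ (y - P y) (P w - P y) ≤ k * ‖P w - P y‖ ^ 2)
    (hlip : ‖P w - P y‖ ≤ 2 * ‖w - y‖) :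
    infDist y X ^ 2 + 2 * inner ℝ (y - P y) (w - y) - 4 * k * ‖w - y‖ ^ 2
      ≤ infDist w X ^ 2 := by
  rw [← (hP w).2, ← (hP y).2]
  have h1 : w - P w = (y - P y) + ((w - y) - (P w - P y)) := by abel
  have h2 : ‖P w - P y‖ ^ 2 ≤ (2 * ‖w - y‖) ^ 2 := pow_le_pow_left₀ (norm_nonneg _) hlip 2
  have h3 := mul_le_mul_of_nonneg_left h2 hk0
  have h4 := sq_nonneg ‖(w - y) - (P w - P y)‖
  rw [h1, norm_add_sq_real, inner_sub_right _ (w - y)]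
  linarith

lemma convexOn_of_subgradient {s : Set E} (hs : Convex ℝ s) {G : E → ℝ} {g : E → E}
    (h : ∀ y ∈ s, ∀ w ∈ s, G y + inner ℝ (g y) (w - y) ≤ G w) : ConvexOn ℝ s G := by
  refine ⟨hs, fun x hx y hy a b ha hb hab => ?_⟩
  have hz := hs hx hy ha hb hab
  have h1 := mul_le_mul_of_nonneg_left (h _ hz x hx) ha
  have h2 := mul_le_mul_of_nonneg_left (h _ hz y hy) hb
  have h3 : a * inner ℝ (g (a • x + b • y)) (x - (a • x + b • y))
      + b * inner ℝ (g (a • x + b • y)) (y - (a • x + b • y)) = 0 := by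
    rw [← real_inner_smul_right, ← real_inner_smul_right, ← inner_add_right]
    have : a • (x - (a • x + b • y)) + b • (y - (a • x + b • y))
        = (1 - (a + b)) • (a • x + b • y) := by module
    rw [this, hab]; simp
  have h4 : G (a • x + b • y) = (a + b) * G (a • x + b • y) := by rw [hab, one_mul]
  simp only [smul_eq_mul]
  linarith

lemma hasGradientAt_of_abs_sub_le [CompleteSpace E] {G : E → ℝ} {v y : E} {C : ℝ}
    (h : ∀ᶠ w in 𝓝 y, |G w - G y - inner ℝ v (w - y)| ≤ C * ‖w - y‖ ^ 2) :
    HasGradientAt G v y := by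
  rw [hasGradientAt_iff_isLittleO]
  have h1 : (fun w => G w - G y - inner ℝ v (w - y)) =O[𝓝 y] fun w => ‖w - y‖ ^ 2 :=
    Asymptotics.IsBigO.of_bound C (by simpa using h)
  have h2 : (fun w : E => ‖w - y‖ ^ 2) =o[𝓝 y] fun w => w - y :=
    Asymptotics.isLittleO_pow_sub_sub y one_lt_two
  exact h1.trans_isLittleO h2

end Inner


/-- Around a local minimum `xbar` of problem (P), for all small
enough penalty parameters `μ`, the exterior-point minimization function
`f + ι̂_μ` is locally strongly convex, differentiable, and has a Lipschitz
gradient on an open ball around `xbar`. -/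
theorem nexos_local_strong_convexity_and_smoothness
    {E : Type*} [NormedAddCommGroup E] [InnerProductSpace ℝ E] [FiniteDimensional ℝ E]
    (X : Set E) (hXne : X.Nonempty) (hXcl : IsClosed X)
    (f : E → ℝ) (f' : E → E) (α L β : ℝ)
    (hα : 0 < α) (hαL : α < L)
    -- `f` is `α`-strongly convex
    (hsc : ConvexOn ℝ Set.univ (fun y => f y - α / 2 * ‖y‖ ^ 2))
    -- `f` is differentiable with gradient `f'`, which is `L`-Lipschitz (`L`-smoothness)
    (hgrad : ∀ x, HasGradientAt f (f' x) x)
    (hlip : ∀ x y, ‖f' x - f' y‖ ≤ L * ‖x - y‖)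
    (hβ : 0 < β)
    -- Assumption 2: the unique minimizer of `f + (β/2)‖·‖²` over `E` does not lie in `X`
    (hassum2 : ∀ z : E, IsMinOn (fun y => f y + β / 2 * ‖y‖ ^ 2) Set.univ z → z ∉ X)
    -- `xbar` is a local minimum of (P)
    (xbar : E) (hxbarX : xbar ∈ X)
    (hproxreg : ∃ δ > 0, ∀ y : E, ‖y - xbar‖ < δ →
      ∃! p, p ∈ X ∧ ‖y - p‖ = Metric.infDist y X)
    (hlocmin : ∃ r > (0 : ℝ), ∀ y ∈ X ∩ Metric.closedBall xbar r, y ≠ xbar →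
      f xbar + β / 2 * ‖xbar‖ ^ 2 < f y + β / 2 * ‖y‖ ^ 2) :
    ∃ μmax > (0 : ℝ), ∀ μ : ℝ, 0 < μ → μ ≤ μmax →
      ∃ rμ > (0 : ℝ), ∃ mμ > (0 : ℝ), ∃ Cμ ≥ (0 : ℝ), ∃ g : E → E,
        StrongConvexOn (Metric.ball xbar rμ) mμ
          (fun y => f y + (Metric.infDist y X) ^ 2 / (2 * μ) + β / 2 * ‖y‖ ^ 2) ∧
        (∀ y ∈ Metric.ball xbar rμ,
          HasGradientAt
            (fun w => f w + (Metric.infDist w X) ^ 2 / (2 * μ) + β / 2 * ‖w‖ ^ 2) (g y) y) ∧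
        (∀ y₁ ∈ Metric.ball xbar rμ, ∀ y₂ ∈ Metric.ball xbar rμ,
          ‖g y₁ - g y₂‖ ≤ Cμ * ‖y₁ - y₂‖) := by
  obtain ⟨δ, hδ, hprox⟩ := hproxreg
  choose P hP using exists_isNearestPoint hXne hXcl
  refine ⟨1, one_pos, fun μ hμ _ => ?_⟩
  obtain ⟨s, hs⟩ : ∃ s, s = min (δ / 4) (α * μ * δ / 8) := ⟨_, rfl⟩
  have hs0 : 0 < s := by rw [hs]; positivity
  have hs1 : s ≤ δ / 4 := hs ▸ min_le_left _ _
  have hs2 : s ≤ α * μ * δ / 8 := hs ▸ min_le_right _ _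
  obtain ⟨k, hk⟩ : ∃ k, k = 2 * s / δ := ⟨_, rfl⟩
  have hk0 : 0 ≤ k := by rw [hk]; positivity
  have hkδ : k * δ = 2 * s := by rw [hk]; field_simp
  have hk1 : k ≤ 1 / 2 := by rw [hk, div_le_iff₀ hδ]; linarith
  have hk2 : 4 * k ≤ α * μ := by
    rw [hk, ← mul_div_assoc, div_le_iff₀ hδ]; linarith
  have hprox_normal : ∀ y ∈ ball xbar s, ∀ b ∈ X,
      2 * inner ℝ (y - P y) (b - P y) ≤ k * ‖b - P y‖ ^ 2 := by
    intro y hy b hb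
    rw [mem_ball] at hy
    have huniq : ∀ z ∈ closedBall y (δ / 2), ∀ p, IsNearestPoint X z p → p = P z := by
      intro z hz p hp
      rw [mem_closedBall] at hz
      refine (hprox z ?_).unique hp (hP z)
      rw [← dist_eq_norm]
      linarith [dist_triangle z y xbar]
    have h1 := inner_sub_le_of_unique_isNearestPoint hXcl hP (half_pos hδ) huniq hb
    have h2 : infDist y X ≤ s := (infDist_le_dist_of_mem hxbarX).trans hy.le
    have h3 := mul_le_mul_of_nonneg_right h2 (sq_nonneg ‖b - P y‖)
    have h4 : 0 ≤ k * ‖b - P y‖ ^ 2 * δ := by positivity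
    have h5 : k * ‖b - P y‖ ^ 2 * δ = 2 * s * ‖b - P y‖ ^ 2 := by rw [← hkδ]; ring
    refine le_of_mul_le_mul_right ?_ hδ
    linarith [mul_nonneg hs0.le (sq_nonneg ‖b - P y‖)]
  have hPlip : ∀ y ∈ ball xbar s, ∀ w ∈ ball xbar s, ‖P w - P y‖ ≤ 2 * ‖w - y‖ :=
    fun y hy w hw => norm_sub_le_of_inner_le hk1 (hprox_normal y hy _ (hP w).1)
      (hprox_normal w hw _ (hP y).1)
  have hlow : ∀ y ∈ ball xbar s, ∀ w ∈ ball xbar s,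
      infDist y X ^ 2 + 2 * inner ℝ (y - P y) (w - y) - 4 * k * ‖w - y‖ ^ 2
        ≤ infDist w X ^ 2 :=
    fun y hy w hw => le_infDist_sq_of_inner_le hP hk0 (hprox_normal y hy _ (hP w).1)
      (hPlip y hy w hw)
  refine ⟨s, hs0, β, hβ, L + 3 / μ + β, by have := hα.trans hαL; positivity,
    fun y => f' y + (1 / μ) • (y - P y) + β • y, ?_, ?_, ?_⟩
  · rw [strongConvexOn_iff_convex]
    have hG : ConvexOn ℝ (ball xbar s)
        (fun y => α / 2 * ‖y‖ ^ 2 + infDist y X ^ 2 / (2 * μ)) := by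
      refine convexOn_of_subgradient (convex_ball _ _)
        (g := fun y => α • y + (1 / μ) • (y - P y)) fun y hy w hw => ?_
      have h1 := hlow y hy w hw
      have h2 : ‖w‖ ^ 2 = ‖y‖ ^ 2 + 2 * inner ℝ y (w - y) + ‖w - y‖ ^ 2 := by
        rw [← norm_add_sq_real, add_sub_cancel]
      have h3 := mul_le_mul_of_nonneg_right hk2 (sq_nonneg ‖w - y‖)
      have h4 : infDist y X ^ 2 / (2 * μ) + (1 / μ) * inner ℝ (y - P y) (w - y)
          - α / 2 * ‖w - y‖ ^ 2 ≤ infDist w X ^ 2 / (2 * μ) := by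
        rw [le_div_iff₀ (by positivity)]
        field_simp
        linarith
      simp only [inner_add_left, real_inner_smul_left]
      rw [h2]
      linarith
    refine ((hsc.subset (Set.subset_univ _) (convex_ball _ _)).add hG).congr fun y _ => ?_
    simp only [Pi.add_apply]
    ring
  · intro y hy
    have hsq : HasGradientAt (fun w => infDist w X ^ 2 / (2 * μ)) ((1 / μ) • (y - P y)) y := by
      refine hasGradientAt_of_abs_sub_le (C := (1 + 4 * k) / (2 * μ)) ?_
      filter_upwards [isOpen_ball.mem_nhds hy] with w hw
      have h1 := hlow y hy w hw
      have h2 := (hP y).infDist_sq_le w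
      have h3 : infDist w X ^ 2 / (2 * μ) - infDist y X ^ 2 / (2 * μ)
          - inner ℝ ((1 / μ) • (y - P y)) (w - y)
          = (infDist w X ^ 2 - infDist y X ^ 2 - 2 * inner ℝ (y - P y) (w - y)) / (2 * μ) := by
        rw [real_inner_smul_left]; field_simp
      rw [h3, abs_div, abs_of_pos (show 0 < 2 * μ by positivity), div_mul_eq_mul_div]
      refine div_le_div_of_nonneg_right (abs_le.2 ⟨?_, ?_⟩) (by positivity)
      · linarith [sq_nonneg ‖w - y‖]
      · linarith [mul_nonneg hk0 (sq_nonneg ‖w - y‖)]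
    have hnorm : HasGradientAt (fun w : E => β / 2 * ‖w‖ ^ 2) (β • y) y := by
      refine hasGradientAt_of_abs_sub_le (C := β / 2) (Eventually.of_forall fun w => ?_)
      have h2 : ‖w‖ ^ 2 = ‖y‖ ^ 2 + 2 * inner ℝ y (w - y) + ‖w - y‖ ^ 2 := by
        rw [← norm_add_sq_real, add_sub_cancel]
      have h3 : β / 2 * ‖w‖ ^ 2 - β / 2 * ‖y‖ ^ 2 - inner ℝ (β • y) (w - y)
          = β / 2 * ‖w - y‖ ^ 2 := by
        rw [real_inner_smul_left, h2]; ring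
      rw [h3, abs_of_nonneg (by positivity)]
    rw [hasGradientAt_iff_hasFDerivAt, map_add, map_add]
    exact ((hgrad y).hasFDerivAt.add hsq.hasFDerivAt).add hnorm.hasFDerivAt
  · intro y hy w hw
    have h1 : f' y + (1 / μ) • (y - P y) + β • y - (f' w + (1 / μ) • (w - P w) + β • w)
        = (f' y - f' w) + (1 / μ) • ((y - w) - (P y - P w)) + β • (y - w) := by module
    have h2 : ‖(y - w) - (P y - P w)‖ ≤ 3 * ‖y - w‖ := by
      linarith [norm_sub_le (y - w) (P y - P w), hPlip w hw y hy]
    have h3 := mul_le_mul_of_nonneg_left h2 (one_div_pos.2 hμ).le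
    calc _ ≤ ‖f' y - f' w‖ + ‖(1 / μ) • ((y - w) - (P y - P w))‖ + ‖β • (y - w)‖ := by
          rw [h1]; exact norm_add₃_le
      _ ≤ L * ‖y - w‖ + (1 / μ) * (3 * ‖y - w‖) + β * ‖y - w‖ := by
          rw [norm_smul, norm_smul, Real.norm_of_nonneg (one_div_pos.2 hμ).le,
            Real.norm_of_nonneg hβ.le]
          linarith [hlip y w]
      _ = (L + 3 / μ + β) * ‖y - w‖ := by ring
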